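/- Let f : ℝ^d → ℝ be twice continuously differentiable and suppose there exist 0 < m ≤ M such that m·I ≤ ∇²f(x) ≤ M·I for all x ∈ ℝ^d. Let γ > 0, α > 0, ρ > 0 and L > 0. Then for any initial condition (x₀, p₀, ξ₀) ∈ ℝ^d × ℝ^d × ℝ^d with ξ₀ ≥ 0 componentwise and ‖x₀‖ + ‖p₀‖ + ‖ξ₀‖ ≤ L, there exist δt* > 0, κ > 0, and C > 0 (depending on L) such that for every step size δt ∈ (0, δt*), the discrete iKFAD iterates satisfy, for all n ≥ 0, f(x_n) − f(x*) + ‖p_n‖² + ‖ξ_n‖² ≤ C·e^{−κ·n·δt}, where x* is the global minimizer of f. -/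

import Mathlib

open RealInnerProductSpace

section TaylorBounds

/-- Second-order Taylor upper bound on `[0, 1]`. -/
lemma taylor_le_of_deriv2_le {φ φ' φ'' : ℝ → ℝ} {c : ℝ}
    (h1 : ∀ t, HasDerivAt φ (φ' t) t) (h2 : ∀ t, HasDerivAt φ' (φ'' t) t)
    (hc : ∀ t, φ'' t ≤ c) : φ 1 ≤ φ 0 + φ' 0 + c / 2 := by
  have hanti : Antitone fun t => φ' t - c * t := by
    have hd : ∀ t, HasDerivAt (fun t => φ' t - c * t) (φ'' t - c * 1) t := fun t =>
      (h2 t).sub ((hasDerivAt_id t).const_mul c)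
    exact antitone_of_deriv_nonpos (fun t => (hd t).differentiableAt) fun t => by
      rw [(hd t).deriv]; linarith [hc t]
  have hd : ∀ t, HasDerivAt (fun t => φ t - φ' 0 * t - c / 2 * t ^ 2)
      (φ' t - φ' 0 * 1 - c / 2 * (2 * t)) t := fun t =>
    (((h1 t).sub ((hasDerivAt_id t).const_mul (φ' 0))).sub
      ((hasDerivAt_pow 2 t).const_mul (c / 2))).congr_deriv (by norm_num)
  have hanti2 : AntitoneOn (fun t => φ t - φ' 0 * t - c / 2 * t ^ 2) (Set.Ici 0) := by
    refine antitoneOn_of_deriv_nonpos (convex_Ici 0)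
      (fun t _ => (hd t).continuousAt.continuousWithinAt)
      (fun t _ => (hd t).differentiableAt.differentiableWithinAt) fun t ht => ?_
    rw [interior_Ici] at ht
    have := hanti (le_of_lt ht)
    rw [(hd t).deriv]
    simp only at this
    linarith
  have := hanti2 (Set.mem_Ici.2 le_rfl) (Set.mem_Ici.2 zero_le_one) zero_le_one
  norm_num at this
  linarith

variable {E : Type*} [NormedAddCommGroup E] [InnerProductSpace ℝ E] [CompleteSpace E]
  {f : E → ℝ}

lemma differentiable_gradient_of_contDiff_two (hf : ContDiff ℝ 2 f) :
    Differentiable ℝ (gradient f) := by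
  have h : Differentiable ℝ (fderiv ℝ f) :=
    (hf.fderiv_right (m := 1) (by norm_num)).differentiable (by norm_num)
  exact (InnerProductSpace.toDual ℝ E).symm.toContinuousLinearEquiv.differentiable.comp h

lemma hasDerivAt_comp_line (hf : ContDiff ℝ 2 f) (x v : E) (t : ℝ) :
    HasDerivAt (fun t : ℝ => f (x + t • v)) ⟪gradient f (x + t • v), v⟫ t := by
  have hl : HasDerivAt (fun t : ℝ => x + t • v) v t := by
    simpa using ((hasDerivAt_id t).smul_const v).const_add x
  have hg := ((hf.differentiable (by norm_num)) (x + t • v)).hasGradientAt.hasFDerivAt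
  exact (hg.comp_hasDerivAt t hl).congr_deriv (by simp)

lemma hasDerivAt_inner_gradient_line (hf : ContDiff ℝ 2 f) (x v : E) (t : ℝ) :
    HasDerivAt (fun t : ℝ => ⟪gradient f (x + t • v), v⟫)
      ⟪v, fderiv ℝ (gradient f) (x + t • v) v⟫ t := by
  have hl : HasDerivAt (fun t : ℝ => x + t • v) v t := by
    simpa using ((hasDerivAt_id t).smul_const v).const_add x
  have hg := (differentiable_gradient_of_contDiff_two hf (x + t • v)).hasFDerivAt
  have := (hg.comp_hasDerivAt t hl).inner ℝ (hasDerivAt_const t v)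
  simpa [real_inner_comm] using this

lemma le_taylor_of_hessian_le {M : ℝ} (hf : ContDiff ℝ 2 f)
    (hM : ∀ x v : E, ⟪v, fderiv ℝ (gradient f) x v⟫ ≤ M * ‖v‖ ^ 2) (x v : E) :
    f (x + v) ≤ f x + ⟪gradient f x, v⟫ + M / 2 * ‖v‖ ^ 2 := by
  have := taylor_le_of_deriv2_le (hasDerivAt_comp_line hf x v)
    (hasDerivAt_inner_gradient_line hf x v) fun t => hM (x + t • v) v
  simp only [one_smul, zero_smul, add_zero] at this
  linarith

lemma taylor_le_of_le_hessian {m : ℝ} (hf : ContDiff ℝ 2 f)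
    (hm : ∀ x v : E, m * ‖v‖ ^ 2 ≤ ⟪v, fderiv ℝ (gradient f) x v⟫) (x v : E) :
    f x + ⟪gradient f x, v⟫ + m / 2 * ‖v‖ ^ 2 ≤ f (x + v) := by
  have := taylor_le_of_deriv2_le (fun t => (hasDerivAt_comp_line hf x v t).neg)
    (fun t => (hasDerivAt_inner_gradient_line hf x v t).neg)
    fun t => neg_le_neg (hm (x + t • v) v)
  simp only [Pi.neg_apply, one_smul, zero_smul, add_zero] at this
  linarith

lemma gradient_eq_zero_of_forall_le {a : E} (h : ∀ y, f a ≤ f y) : gradient f a = 0 := by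
  have : IsLocalMin f a := Filter.Eventually.of_forall h
  simp [gradient, this.fderiv_eq_zero]

lemma gap_le_of_hessian_le {M : ℝ} (hf : ContDiff ℝ 2 f)
    (hM : ∀ x v : E, ⟪v, fderiv ℝ (gradient f) x v⟫ ≤ M * ‖v‖ ^ 2)
    {a : E} (ha : ∀ y, f a ≤ f y) (x : E) : f x - f a ≤ M / 2 * ‖x - a‖ ^ 2 := by
  have := le_taylor_of_hessian_le hf hM a (x - a)
  rw [gradient_eq_zero_of_forall_le ha, inner_zero_left, add_sub_cancel] at this
  linarith

lemma norm_gradient_sq_le {M : ℝ} (hM0 : 0 < M) (hf : ContDiff ℝ 2 f)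
    (hM : ∀ x v : E, ⟪v, fderiv ℝ (gradient f) x v⟫ ≤ M * ‖v‖ ^ 2)
    {a : E} (ha : ∀ y, f a ≤ f y) (x : E) :
    ‖gradient f x‖ ^ 2 ≤ M ^ 2 * ‖x - a‖ ^ 2 := by
  have h1 := le_taylor_of_hessian_le hf hM x (-(1 / M) • gradient f x)
  have h2 := gap_le_of_hessian_le hf hM ha x
  have h3 := ha (x + -(1 / M) • gradient f x)
  rw [inner_smul_right, real_inner_self_eq_norm_sq, norm_smul, mul_pow, Real.norm_eq_abs,
    sq_abs] at h1
  have h4 : M / 2 * ((-(1 / M)) ^ 2 * ‖gradient f x‖ ^ 2)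
      = 1 / 2 * (1 / M * ‖gradient f x‖ ^ 2) := by field_simp
  have h5 : 1 / M * ‖gradient f x‖ ^ 2 ≤ M * ‖x - a‖ ^ 2 := by linarith
  calc ‖gradient f x‖ ^ 2 = M * (1 / M * ‖gradient f x‖ ^ 2) := by field_simp
    _ ≤ M * (M * ‖x - a‖ ^ 2) := by gcongr
    _ = _ := by ring

lemma le_gap_of_le_hessian {m : ℝ} (hf : ContDiff ℝ 2 f)
    (hm : ∀ x v : E, m * ‖v‖ ^ 2 ≤ ⟪v, fderiv ℝ (gradient f) x v⟫)
    {a : E} (ha : ∀ y, f a ≤ f y) (x : E) : m / 2 * ‖x - a‖ ^ 2 ≤ f x - f a := by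
  have := taylor_le_of_le_hessian hf hm a (x - a)
  rw [gradient_eq_zero_of_forall_le ha, inner_zero_left, add_sub_cancel] at this
  linarith

lemma le_inner_gradient_of_le_hessian {m : ℝ} (hf : ContDiff ℝ 2 f)
    (hm : ∀ x v : E, m * ‖v‖ ^ 2 ≤ ⟪v, fderiv ℝ (gradient f) x v⟫)
    {a : E} (ha : ∀ y, f a ≤ f y) (x : E) :
    m * ‖x - a‖ ^ 2 ≤ ⟪gradient f x, x - a⟫ := by
  have := taylor_le_of_le_hessian hf hm x (-(x - a))
  rw [inner_neg_right, norm_neg, neg_sub, add_sub_cancel] at this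
  linarith [le_gap_of_le_hessian hf hm ha x]

end TaylorBounds

section OneStep

variable {E : Type*} [NormedAddCommGroup E] [InnerProductSpace ℝ E]

/-- Dissipation of the energy `2 (f - f*) + ‖p‖² + z` in one step `q - h g`, where `q` is the
damped momentum. -/
lemma energy_step {q g : E} {F F' P z z' M μ h : ℝ} (hM : 0 < M) (hh : 0 < h)
    (hz' : 0 ≤ z') (hP : 0 ≤ P) (hz : 0 ≤ z) (hμ : 0 < μ)
    (hhM : 4 * M * h ≤ μ) (hhM' : 2 * M * h ^ 2 ≤ 1)
    (hq : ‖q‖ ^ 2 + z' ≤ (1 - μ * h) * (P + z))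
    (hF : F' ≤ F + ⟪g, h • (q - h • g)⟫ + M / 2 * ‖h • (q - h • g)‖ ^ 2) :
    2 * F' + ‖q - h • g‖ ^ 2 + z' ≤ 2 * F + P + z - μ / 2 * h * (P + z) := by
  have e1 : ‖q - h • g‖ ^ 2 = ‖q‖ ^ 2 - 2 * h * ⟪g, q⟫ + h ^ 2 * ‖g‖ ^ 2 := by
    rw [norm_sub_sq_real, inner_smul_right, norm_smul, mul_pow, Real.norm_eq_abs, sq_abs,
      real_inner_comm]
    ring
  have e2 : ‖q + h • g‖ ^ 2 = ‖q‖ ^ 2 + 2 * h * ⟪g, q⟫ + h ^ 2 * ‖g‖ ^ 2 := by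
    rw [norm_add_sq_real, inner_smul_right, norm_smul, mul_pow, Real.norm_eq_abs, sq_abs,
      real_inner_comm]
    ring
  rw [norm_smul, mul_pow, Real.norm_eq_abs, sq_abs, inner_smul_right, inner_sub_right,
    inner_smul_right, real_inner_self_eq_norm_sq] at hF
  have hp : ‖q - h • g‖ ^ 2 ≤ 2 * ‖q‖ ^ 2 + 2 * h ^ 2 * ‖g‖ ^ 2 := by
    nlinarith [sq_nonneg ‖q + h • g‖]
  have hqS : ‖q‖ ^ 2 ≤ P + z := by
    have : 0 ≤ μ * h * (P + z) := by positivity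
    linarith
  have h1 : M * h ^ 2 * ‖q - h • g‖ ^ 2 ≤ M * h ^ 2 * (2 * (P + z) + 2 * h ^ 2 * ‖g‖ ^ 2) := by
    gcongr; linarith
  have h2 : 4 * M * h * (h * (P + z)) ≤ μ * (h * (P + z)) := by gcongr
  have h3 : 2 * M * h ^ 2 * (h ^ 2 * ‖g‖ ^ 2) ≤ 1 * (h ^ 2 * ‖g‖ ^ 2) := by gcongr
  nlinarith

/-- One-step bound for the cross term `⟪p, x - x*⟫`. -/
lemma cross_step {p q g y : E} {m M K h : ℝ} (hm : 0 < m) (hh : 0 < h)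
    (hhM : 8 * h ^ 2 * M ^ 2 ≤ m)
    (hpq : ‖p - q‖ ≤ K * h * ‖p‖) (hq : ‖q‖ ^ 2 ≤ ‖p‖ ^ 2)
    (hg : m * ‖y‖ ^ 2 ≤ ⟪g, y⟫) (hgM : ‖g‖ ^ 2 ≤ M ^ 2 * ‖y‖ ^ 2) :
    ⟪q - h • g, y + h • (q - h • g)⟫ ≤
      ⟪p, y⟫ + h * ((K ^ 2 / m + 2) * ‖p‖ ^ 2 - m / 2 * ‖y‖ ^ 2) := by
  have e2 := parallelogram_law_with_norm ℝ q (h • g)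
  have hp : ‖q - h • g‖ ^ 2 ≤ 2 * ‖q‖ ^ 2 + 2 * h ^ 2 * ‖g‖ ^ 2 := by
    have e3 : ‖h • g‖ * ‖h • g‖ = h ^ 2 * ‖g‖ ^ 2 := by
      rw [norm_smul, Real.norm_eq_abs, mul_mul_mul_comm, abs_mul_abs_self]; ring
    nlinarith [mul_self_nonneg ‖q + h • g‖]
  have e4 : ⟪q - h • g, y + h • (q - h • g)⟫
      = ⟪p, y⟫ - ⟪p - q, y⟫ - h * ⟪g, y⟫ + h * ‖q - h • g‖ ^ 2 := by
    rw [inner_add_right, inner_smul_right, real_inner_self_eq_norm_sq, inner_sub_left,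
      inner_sub_left, real_inner_smul_left]
    ring
  have h1 : -⟪p - q, y⟫ ≤ K * h * ‖p‖ * ‖y‖ :=
    (neg_le_abs _).trans ((abs_real_inner_le_norm _ _).trans (by gcongr))
  have h2 : K * ‖p‖ * ‖y‖ ≤ K ^ 2 / m * ‖p‖ ^ 2 + m / 4 * ‖y‖ ^ 2 := by
    have : K ^ 2 / m * ‖p‖ ^ 2 + m / 4 * ‖y‖ ^ 2 - K * ‖p‖ * ‖y‖
        = (K * ‖p‖ - m / 2 * ‖y‖) ^ 2 / m := by field_simp; ring
    have : 0 ≤ (K * ‖p‖ - m / 2 * ‖y‖) ^ 2 / m := by positivity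
    linarith
  have h3 : h ^ 2 * ‖g‖ ^ 2 ≤ h ^ 2 * (M ^ 2 * ‖y‖ ^ 2) := by gcongr
  have h4 : 8 * h ^ 2 * M ^ 2 * ‖y‖ ^ 2 ≤ m * ‖y‖ ^ 2 := by gcongr
  have h5 : K * ‖p‖ * ‖y‖ - ⟪g, y⟫ + ‖q - h • g‖ ^ 2 ≤
      (K ^ 2 / m + 2) * ‖p‖ ^ 2 - m / 2 * ‖y‖ ^ 2 := by linarith
  have h6 := mul_le_mul_of_nonneg_left h5 hh.le
  rw [e4]
  linarith

end OneStep

section Coordinates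

lemma exp_neg_le_one_sub_half {t : ℝ} (h0 : 0 ≤ t) (h1 : t ≤ 1) :
    Real.exp (-t) ≤ 1 - t / 2 := by
  rw [Real.exp_neg]
  have h2 : 0 < 1 + t := by linarith
  calc (Real.exp t)⁻¹ ≤ (1 + t)⁻¹ := by
        gcongr; linarith [Real.add_one_le_exp t]
    _ ≤ 1 - t / 2 := by
        rw [inv_le_iff_one_le_mul₀ h2]; nlinarith

/-- Exact dissipation of the damping part of the iteration, in one coordinate. -/
lemma damping_coord_le {γ α ρ h μ p ξ : ℝ} (hρ : 0 < ρ) (hh : 0 < h)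
    (hμγ : μ ≤ γ) (hμα : μ ≤ α) (hξ : 0 ≤ ξ) :
    (Real.exp (-(γ + ξ) * h) * p) ^ 2 + ρ * (Real.exp (-α * h) *
      Real.sqrt (ξ ^ 2 + (1 - Real.exp (-2 * ξ * h)) * p ^ 2 / ρ)) ^ 2 ≤
      Real.exp (-(2 * μ * h)) * (p ^ 2 + ρ * ξ ^ 2) := by
  have h1 : Real.exp (-2 * ξ * h) ≤ 1 := Real.exp_le_one_iff.2 (by nlinarith)
  have h2 : 0 ≤ (1 - Real.exp (-2 * ξ * h)) * p ^ 2 := mul_nonneg (by linarith) (sq_nonneg p)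
  have e1 : Real.exp (-(γ + ξ) * h) ^ 2 = Real.exp (-(2 * γ * h)) * Real.exp (-2 * ξ * h) := by
    rw [← Real.exp_nat_mul, ← Real.exp_add]; congr 1; push_cast; ring
  have e2 : Real.exp (-α * h) ^ 2 = Real.exp (-(2 * α * h)) := by
    rw [← Real.exp_nat_mul]; congr 1; push_cast; ring
  rw [mul_pow, mul_pow, Real.sq_sqrt (by positivity), e1, e2]
  have h3 : Real.exp (-(2 * γ * h)) ≤ Real.exp (-(2 * μ * h)) := by gcongr
  have h4 : Real.exp (-(2 * α * h)) ≤ Real.exp (-(2 * μ * h)) := by gcongr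
  calc _ = Real.exp (-(2 * γ * h)) * (Real.exp (-2 * ξ * h) * p ^ 2) +
        Real.exp (-(2 * α * h)) * (ρ * ξ ^ 2 + (1 - Real.exp (-2 * ξ * h)) * p ^ 2) := by
        field_simp
    _ ≤ Real.exp (-(2 * μ * h)) * (Real.exp (-2 * ξ * h) * p ^ 2) +
        Real.exp (-(2 * μ * h)) * (ρ * ξ ^ 2 + (1 - Real.exp (-2 * ξ * h)) * p ^ 2) := by
        gcongr
    _ = _ := by ring

variable {d : ℕ} {p q ξ ξ' : EuclideanSpace ℝ (Fin d)} {γ α ρ h μ : ℝ}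

lemma damping_le (hρ : 0 < ρ) (hh : 0 < h) (hμ : 0 < μ)
    (hμγ : μ ≤ γ) (hμα : μ ≤ α) (hμh : 2 * μ * h ≤ 1) (hξ : ∀ i, 0 ≤ ξ i)
    (hq : ∀ i, q i = Real.exp (-(γ + ξ i) * h) * p i)
    (hξ' : ∀ i, ξ' i = Real.exp (-α * h) *
      Real.sqrt ((ξ i) ^ 2 + (1 - Real.exp (-2 * ξ i * h)) * (p i) ^ 2 / ρ)) :
    ‖q‖ ^ 2 + ρ * ‖ξ'‖ ^ 2 ≤ (1 - μ * h) * (‖p‖ ^ 2 + ρ * ‖ξ‖ ^ 2) := by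
  have h1 : ‖q‖ ^ 2 + ρ * ‖ξ'‖ ^ 2 ≤
      Real.exp (-(2 * μ * h)) * (‖p‖ ^ 2 + ρ * ‖ξ‖ ^ 2) := by
    simp only [EuclideanSpace.real_norm_sq_eq, Finset.mul_sum, ← Finset.sum_add_distrib]
    refine Finset.sum_le_sum fun i _ => ?_
    rw [hq, hξ']
    exact damping_coord_le hρ hh hμγ hμα (hξ i)
  refine h1.trans ?_
  gcongr
  linarith [exp_neg_le_one_sub_half (t := 2 * μ * h) (by positivity) hμh]

lemma norm_damped_le (hh : 0 < h) (hγ : 0 < γ) (hξ : ∀ i, 0 ≤ ξ i)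
    (hq : ∀ i, q i = Real.exp (-(γ + ξ i) * h) * p i) : ‖q‖ ^ 2 ≤ ‖p‖ ^ 2 := by
  simp only [EuclideanSpace.real_norm_sq_eq]
  refine Finset.sum_le_sum fun i _ => ?_
  rw [hq, mul_pow]
  have h0 : 0 ≤ (γ + ξ i) * h := mul_nonneg (add_nonneg hγ.le (hξ i)) hh.le
  have h1 : Real.exp (-(γ + ξ i) * h) ≤ 1 := Real.exp_le_one_iff.2 (by linarith)
  exact mul_le_of_le_one_left (sq_nonneg _) (pow_le_one₀ (Real.exp_pos _).le h1)

lemma norm_sub_damped_le {R : ℝ} (hh : 0 < h) (hγ : 0 < γ) (hR : 0 ≤ R)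
    (hξ : ∀ i, 0 ≤ ξ i) (hξR : ∀ i, ξ i ≤ R)
    (hq : ∀ i, q i = Real.exp (-(γ + ξ i) * h) * p i) :
    ‖p - q‖ ≤ (γ + R) * h * ‖p‖ := by
  refine le_of_sq_le_sq ?_ (by positivity)
  rw [mul_pow]
  simp only [EuclideanSpace.real_norm_sq_eq, Finset.mul_sum]
  refine Finset.sum_le_sum fun i _ => ?_
  rw [PiLp.sub_apply, hq]
  have h0 : 0 ≤ (γ + ξ i) * h := mul_nonneg (add_nonneg hγ.le (hξ i)) hh.le
  have h1 : Real.exp (-(γ + ξ i) * h) ≤ 1 := Real.exp_le_one_iff.2 (by linarith)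
  have h2 := Real.add_one_le_exp (-(γ + ξ i) * h)
  have h3 : (γ + ξ i) * h ≤ (γ + R) * h := by gcongr; exact hξR i
  have h4 : (1 - Real.exp (-(γ + ξ i) * h)) ^ 2 ≤ ((γ + R) * h) ^ 2 :=
    pow_le_pow_left₀ (by linarith) (by linarith) 2
  calc _ = (1 - Real.exp (-(γ + ξ i) * h)) ^ 2 * p i ^ 2 := by ring
    _ ≤ _ := by gcongr

end Coordinates

/-- Contraction of the Lyapunov function `2 F + P² + z + ε c`, where `F` stands for the
objective gap, `P` and `Y` for the norms of momentum and displacement, and `c` for their inner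
product. -/
lemma lyapunov_step {F F' P P' Y z z' c c' m M K μ ε h κ : ℝ} (hh : 0 < h)
    (hε : 0 < ε) (hε1 : ε ≤ 1) (hεK : ε * (K ^ 2 / m + 2) ≤ μ / 4) (hz : 0 ≤ z)
    (hκ1 : κ * (M + 1) ≤ ε * m / 2) (hκ2 : 8 * κ ≤ μ) (hκ : 0 < κ)
    (hF : F ≤ M / 2 * Y ^ 2) (hc : |c| ≤ P * Y)
    (hE : 2 * F' + P' ^ 2 + z' ≤ 2 * F + P ^ 2 + z - μ / 2 * h * (P ^ 2 + z))
    (hC : c' ≤ c + h * ((K ^ 2 / m + 2) * P ^ 2 - m / 2 * Y ^ 2)) :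
    2 * F' + P' ^ 2 + z' + ε * c' ≤ (1 - κ * h) * (2 * F + P ^ 2 + z + ε * c) := by
  have h1 : ε * c' ≤ ε * (c + h * ((K ^ 2 / m + 2) * P ^ 2 - m / 2 * Y ^ 2)) := by gcongr
  have h2 : ε * (K ^ 2 / m + 2) * (h * P ^ 2) ≤ μ / 4 * (h * P ^ 2) := by gcongr
  have h3 : ε * c ≤ P ^ 2 + Y ^ 2 := by
    have h4 : ε * c ≤ ε * |c| := by gcongr; exact le_abs_self c
    have h5 : ε * |c| ≤ 1 * |c| := by gcongr
    nlinarith [sq_nonneg (P - Y), sq_nonneg P, sq_nonneg Y]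
  have h6 : κ * h * (2 * F + P ^ 2 + z + ε * c) ≤
      κ * h * ((M + 1) * Y ^ 2 + 2 * P ^ 2 + z) := by
    gcongr κ * h * ?_
    linarith
  have h7 : κ * (M + 1) * (h * Y ^ 2) ≤ ε * m / 2 * (h * Y ^ 2) := by gcongr
  have h8 : 8 * κ * (h * P ^ 2) ≤ μ * (h * P ^ 2) := by gcongr
  have h9 : 8 * κ * (h * z) ≤ μ * (h * z) := by gcongr
  have h10 : 0 ≤ κ * (h * z) := by positivity
  linarith

lemma le_mul_exp_of_contraction {V : ℕ → ℝ} {a : ℝ} (hV : ∀ n, 0 ≤ V n)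
    (h : ∀ n, V (n + 1) ≤ (1 - a) * V n) (n : ℕ) : V n ≤ V 0 * Real.exp (-a * n) := by
  induction n with
  | zero => simp
  | succ n ih =>
    calc V (n + 1) ≤ (1 - a) * V n := h n
      _ ≤ Real.exp (-a) * V n := by
        gcongr
        · exact hV n
        · linarith [Real.add_one_le_exp (-a)]
      _ ≤ Real.exp (-a) * (V 0 * Real.exp (-a * n)) := by gcongr
      _ = V 0 * (Real.exp (-a * n) * Real.exp (-a)) := by ring
      _ = _ := by rw [← Real.exp_add]; push_cast; ring_nf

lemma exists_cross_weight {m μ B : ℝ} (hm : 0 < m) (hμ : 0 < μ) (hB : 0 ≤ B) :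
    ∃ ε : ℝ, 0 < ε ∧ ε ≤ 1 ∧ ε ≤ m ∧ ε * B ≤ μ / 4 := by
  refine ⟨min (min 1 m) (μ / 4 / (B + 1)), by positivity,
    (min_le_left _ _).trans (min_le_left _ _), (min_le_left _ _).trans (min_le_right _ _), ?_⟩
  calc _ ≤ μ / 4 / (B + 1) * (B + 1) := by
        gcongr
        · exact min_le_right _ _
        · linarith
    _ = μ / 4 := by field_simp

lemma exists_decay_rate {M μ c : ℝ} (hM : 0 < M) (hμ : 0 < μ) (hc : 0 < c) :
    ∃ κ : ℝ, 0 < κ ∧ κ * (M + 1) ≤ c ∧ 8 * κ ≤ μ := by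
  refine ⟨min (c / (M + 1)) (μ / 8), by positivity, ?_, ?_⟩
  · rw [← le_div_iff₀ (by positivity)]
    exact min_le_left _ _
  · linarith [min_le_right (c / (M + 1)) (μ / 8)]

lemma exists_step_bound {m M μ : ℝ} (hm : 0 < m) (hM : 0 < M) (hμ : 0 < μ) :
    ∃ s : ℝ, 0 < s ∧ ∀ h : ℝ, 0 < h → h < s →
      4 * M * h ≤ μ ∧ 2 * μ * h ≤ 1 ∧ 2 * M * h ^ 2 ≤ 1 ∧ 8 * h ^ 2 * M ^ 2 ≤ m := by
  refine ⟨min (min 1 (μ / (4 * M)))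
    (min (1 / (2 * μ)) (min (1 / (2 * M)) (m / (8 * M ^ 2)))), by positivity, ?_⟩
  intro h hh hs
  simp only [lt_min_iff] at hs
  obtain ⟨⟨h1, h2⟩, h3, h4, h5⟩ := hs
  have hsq : h ^ 2 ≤ h := by nlinarith
  have h4' := hsq.trans h4.le
  have h5' := hsq.trans h5.le
  rw [lt_div_iff₀ (by positivity)] at h2 h3
  rw [le_div_iff₀ (by positivity)] at h4' h5'
  exact ⟨by linarith, by linarith, by linarith, by linarith⟩

/-- Exponential (geometric) convergence of the discrete iKFAD iteration
`p_{n+1} = β_{n,δt} p_n - δt ∇f(x_n)`,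
`x_{n+1} = x_n + δt β_{n,δt} p_n - δt² ∇f(x_n)`,
`ξ_{n+1} = e^{-αδt} ([ξ_n]² + (I - e^{-2Ξ_n δt})[p_n]²/ρ)^{1/2}`,
with `β_{n,δt} = e^{-(γI + Ξ_n)δt}` acting componentwise, for a strongly convex
objective with bounded Hessian and sufficiently small step size. -/
theorem ikfad_discrete_exponential_convergence
    (d : ℕ) (f : EuclideanSpace ℝ (Fin d) → ℝ)
    (hf : ContDiff ℝ 2 f)
    (m M : ℝ) (hm : 0 < m) (hmM : m ≤ M)
    (hHess : ∀ (x v : EuclideanSpace ℝ (Fin d)),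
      m * ‖v‖ ^ 2 ≤ ⟪v, fderiv ℝ (gradient f) x v⟫ ∧
      ⟪v, fderiv ℝ (gradient f) x v⟫ ≤ M * ‖v‖ ^ 2)
    (xstar : EuclideanSpace ℝ (Fin d)) (hmin : ∀ y, f xstar ≤ f y)
    (γ α ρ L : ℝ) (hγ : 0 < γ) (hα : 0 < α) (hρ : 0 < ρ) (hL : 0 < L)
    (x0 p0 ξ0 : EuclideanSpace ℝ (Fin d))
    (hξ0 : ∀ i, 0 ≤ ξ0 i)
    (hinit : ‖x0‖ + ‖p0‖ + ‖ξ0‖ ≤ L) :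
    ∃ δtstar : ℝ, 0 < δtstar ∧ ∃ κ : ℝ, 0 < κ ∧ ∃ C : ℝ, 0 < C ∧
      ∀ δt : ℝ, 0 < δt → δt < δtstar →
      ∀ x p ξ : ℕ → EuclideanSpace ℝ (Fin d),
        x 0 = x0 → p 0 = p0 → ξ 0 = ξ0 →
        (∀ n i, p (n + 1) i =
          Real.exp (-(γ + ξ n i) * δt) * p n i - δt * gradient f (x n) i) →
        (∀ n i, x (n + 1) i =
          x n i + δt * (Real.exp (-(γ + ξ n i) * δt) * p n i) -
            δt ^ 2 * gradient f (x n) i) →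
        (∀ n i, ξ (n + 1) i =
          Real.exp (-α * δt) *
            Real.sqrt ((ξ n i) ^ 2 +
              (1 - Real.exp (-2 * ξ n i * δt)) * (p n i) ^ 2 / ρ)) →
        ∀ n : ℕ,
          f (x n) - f xstar + ‖p n‖ ^ 2 + ‖ξ n‖ ^ 2 ≤
            C * Real.exp (-κ * n * δt) := by
  have hM : 0 < M := hm.trans_le hmM
  have hUp := le_taylor_of_hessian_le hf fun x v => (hHess x v).2
  have hgM := norm_gradient_sq_le hM hf (fun x v => (hHess x v).2) hmin
  have hgap_le := gap_le_of_hessian_le hf (fun x v => (hHess x v).2) hmin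
  have hle_gap := le_gap_of_le_hessian hf (fun x v => (hHess x v).1) hmin
  have hmono := le_inner_gradient_of_le_hessian hf (fun x v => (hHess x v).1) hmin
  set E0 : ℝ := 2 * (f x0 - f xstar) + ‖p0‖ ^ 2 + ρ * ‖ξ0‖ ^ 2 with hE0
  set K : ℝ := γ + Real.sqrt (E0 / ρ) with hK
  obtain ⟨μ, hμ, hμγ, hμα⟩ : ∃ μ : ℝ, 0 < μ ∧ μ ≤ γ ∧ μ ≤ α :=
    ⟨min γ α, lt_min hγ hα, min_le_left _ _, min_le_right _ _⟩
  obtain ⟨ε, hε, hε1, hεm, hεK⟩ :=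
    exists_cross_weight hm hμ (show 0 ≤ K ^ 2 / m + 2 by positivity)
  obtain ⟨κ, hκ, hκ1, hκ2⟩ := exists_decay_rate hM hμ (show 0 < ε * m / 2 by positivity)
  obtain ⟨s, hs, hstep⟩ := exists_step_bound hm hM hμ
  have hc_le : ∀ x p : EuclideanSpace ℝ (Fin d), |ε * ⟪p, x - xstar⟫| ≤
      (f x - f xstar) + ‖p‖ ^ 2 / 2 := fun x p => by
    rw [abs_mul, abs_of_pos hε]
    have h1 : ε * |⟪p, x - xstar⟫| ≤ ε * (‖p‖ * ‖x - xstar‖) := by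
      gcongr; exact abs_real_inner_le_norm _ _
    have h2 : ε * ‖p‖ ^ 2 ≤ 1 * ‖p‖ ^ 2 := by gcongr
    have h3 : ε * ‖x - xstar‖ ^ 2 ≤ m * ‖x - xstar‖ ^ 2 := by gcongr
    have h4 : 0 ≤ ε * (‖p‖ - ‖x - xstar‖) ^ 2 := by positivity
    linarith [hle_gap x]
  have hV0 : 0 ≤ E0 + ε * ⟪p0, x0 - xstar⟫ := by
    have := neg_le_of_abs_le (hc_le x0 p0)
    have h1 : 0 ≤ ρ * ‖ξ0‖ ^ 2 := by positivity
    linarith [hmin x0, sq_nonneg ‖p0‖]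
  refine ⟨s, hs, κ, hκ, 2 * (1 + 1 / ρ) * (E0 + ε * ⟪p0, x0 - xstar⟫) + 1, by positivity, ?_⟩
  intro h hh hhs x p ξ hx0 hp0 hξ0' hp hx hξ
  obtain ⟨hhμM, hhμ, hhM, hhm⟩ := hstep h hh hhs
  have hξnn : ∀ n i, 0 ≤ ξ n i := by
    rintro (_ | n) i
    · rw [hξ0']; exact hξ0 i
    · rw [hξ]; positivity
  let q : ℕ → EuclideanSpace ℝ (Fin d) := fun n => p (n + 1) + h • gradient f (x n)
  have hq : ∀ n i, q n i = Real.exp (-(γ + ξ n i) * h) * p n i := fun n i => by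
    simp [q, hp n i]
  have hp' : ∀ n, p (n + 1) = q n - h • gradient f (x n) := fun n => by simp [q]
  have hx' : ∀ n, x (n + 1) = x n + h • (q n - h • gradient f (x n)) := fun n => by
    ext i
    simp [hq n i, hx n i]
    ring
  have hE : ∀ n, 2 * (f (x (n + 1)) - f xstar) + ‖p (n + 1)‖ ^ 2 + ρ * ‖ξ (n + 1)‖ ^ 2 ≤
      2 * (f (x n) - f xstar) + ‖p n‖ ^ 2 + ρ * ‖ξ n‖ ^ 2 -
        μ / 2 * h * (‖p n‖ ^ 2 + ρ * ‖ξ n‖ ^ 2) := fun n => by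
    have hF := hUp (x n) (h • (q n - h • gradient f (x n)))
    rw [← hx'] at hF
    rw [hp']
    exact energy_step hM hh (by positivity) (by positivity) (by positivity) hμ hhμM hhM
      (damping_le hρ hh hμ hμγ hμα hhμ (hξnn n) (hq n) (hξ n)) (by linarith)
  have hEle : ∀ n, 2 * (f (x n) - f xstar) + ‖p n‖ ^ 2 + ρ * ‖ξ n‖ ^ 2 ≤ E0 := fun n => by
    induction n with
    | zero => rw [hx0, hp0, hξ0']
    | succ n ih =>
      have : 0 ≤ μ / 2 * h * (‖p n‖ ^ 2 + ρ * ‖ξ n‖ ^ 2) := by positivity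
      linarith [hE n]
  have hξR : ∀ n i, ξ n i ≤ Real.sqrt (E0 / ρ) := fun n i => by
    refine Real.le_sqrt_of_sq_le ?_
    rw [le_div_iff₀ hρ]
    have h1 : ξ n i ^ 2 ≤ ‖ξ n‖ ^ 2 := by
      rw [EuclideanSpace.real_norm_sq_eq]
      exact Finset.single_le_sum (f := fun i => ξ n i ^ 2) (fun i _ => sq_nonneg _)
        (Finset.mem_univ i)
    have h2 : ρ * ξ n i ^ 2 ≤ ρ * ‖ξ n‖ ^ 2 := by gcongr
    linarith [hEle n, hmin (x n), sq_nonneg ‖p n‖]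
  have hC : ∀ n, ⟪p (n + 1), x (n + 1) - xstar⟫ ≤ ⟪p n, x n - xstar⟫ +
      h * ((K ^ 2 / m + 2) * ‖p n‖ ^ 2 - m / 2 * ‖x n - xstar‖ ^ 2) := fun n => by
    rw [hp', hx', add_sub_right_comm (x n) _ xstar]
    exact cross_step hm hh hhm
      (norm_sub_damped_le hh hγ (Real.sqrt_nonneg _) (hξnn n) (hξR n) (hq n))
      (norm_damped_le hh hγ (hξnn n) (hq n)) (hmono (x n)) (hgM (x n))
  have hVlow : ∀ n, f (x n) - f xstar + ‖p n‖ ^ 2 / 2 + ρ * ‖ξ n‖ ^ 2 ≤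
      2 * (f (x n) - f xstar) + ‖p n‖ ^ 2 + ρ * ‖ξ n‖ ^ 2 + ε * ⟪p n, x n - xstar⟫ := fun n => by
    linarith [neg_le_of_abs_le (hc_le (x n) (p n))]
  have hdecay := le_mul_exp_of_contraction (a := κ * h)
    (V := fun n => 2 * (f (x n) - f xstar) + ‖p n‖ ^ 2 + ρ * ‖ξ n‖ ^ 2 +
      ε * ⟪p n, x n - xstar⟫)
    (fun n => (add_nonneg (add_nonneg (sub_nonneg.2 (hmin _)) (by positivity))
      (by positivity)).trans (hVlow n))
    (fun n => lyapunov_step hh hε hε1 hεK (by positivity) hκ1 hκ2 hκ (hgap_le (x n))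
      (abs_real_inner_le_norm _ _) (hE n) (hC n))
  intro n
  have hn := (hVlow n).trans (hdecay n)
  simp only [hx0, hp0, hξ0', ← hE0] at hn
  have hexp : -(κ * h) * n = -κ * n * h := by ring
  rw [hexp] at hn
  have hξeq : ‖ξ n‖ ^ 2 = 1 / ρ * (ρ * ‖ξ n‖ ^ 2) := by field_simp
  have hgap : 0 ≤ f (x n) - f xstar := sub_nonneg.2 (hmin _)
  have hρ' : 0 < 1 / ρ := by positivity
  have hsplit : f (x n) - f xstar + ‖p n‖ ^ 2 + ‖ξ n‖ ^ 2 ≤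
      2 * (1 + 1 / ρ) * (f (x n) - f xstar + ‖p n‖ ^ 2 / 2 + ρ * ‖ξ n‖ ^ 2) := by
    have h1 : 0 ≤ 1 / ρ * (f (x n) - f xstar + ‖p n‖ ^ 2 / 2) := by positivity
    have h2 : 0 ≤ 1 / ρ * (ρ * ‖ξ n‖ ^ 2) := by positivity
    have h3 : 0 ≤ ρ * ‖ξ n‖ ^ 2 := by positivity
    linarith
  refine hsplit.trans ?_
  calc _ ≤ 2 * (1 + 1 / ρ) * ((E0 + ε * ⟪p0, x0 - xstar⟫) * Real.exp (-κ * n * h)) :=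
        mul_le_mul_of_nonneg_left hn (by positivity)
    _ ≤ _ := by linarith [Real.exp_pos (-κ * n * h)]
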